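/- arXiv:math/0608009 — 4 statements merged into one kernel-verified Lean document; each statement's English description precedes it below -/
import Mathlib

section
/- Let R be a commutative ring with n! invertible in R, and let φ be an R-algebra endomorphism of R[X_1,...,X_{2n}] preserving the canonical Poisson bracket (an endomorphism of the n-th canonical Poisson algebra over R). Then det(Jφ) = 1. -/
open MvPolynomial

/-- The canonical Poisson bracket on `R[X_1,...,X_{2n}]`, with the first `n`
variables indexed by `Sum.inl` and the last `n` by `Sum.inr`. -/
noncomputable def poissonBracket {R : Type*} [CommRing R] {n : ℕ}
    (f g : MvPolynomial (Fin n ⊕ Fin n) R) : MvPolynomial (Fin n ⊕ Fin n) R :=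
  ∑ i : Fin n,
    (pderiv (Sum.inl i) f * pderiv (Sum.inr i) g
      - pderiv (Sum.inr i) f * pderiv (Sum.inl i) g)

/-- The Jacobian matrix of an algebra endomorphism of `R[X_1,...,X_{2n}]`. -/
noncomputable def jacobianMatrix {R : Type*} [CommRing R] {n : ℕ}
    (φ : MvPolynomial (Fin n ⊕ Fin n) R →ₐ[R] MvPolynomial (Fin n ⊕ Fin n) R) :
    Matrix (Fin n ⊕ Fin n) (Fin n ⊕ Fin n) (MvPolynomial (Fin n ⊕ Fin n) R) :=
  fun i j => pderiv j (φ (X i))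

/-- The Poisson bracket on the images of the variables is the
congruence of `-J` by the Jacobian matrix. -/
theorem jacobianMatrix_mul_J_mul_transpose_apply {R : Type*} [CommRing R] {n : ℕ}
    (φ : MvPolynomial (Fin n ⊕ Fin n) R →ₐ[R] MvPolynomial (Fin n ⊕ Fin n) R)
    (i j : Fin n ⊕ Fin n) :
    (jacobianMatrix φ * Matrix.J (Fin n) (MvPolynomial (Fin n ⊕ Fin n) R) *
      (jacobianMatrix φ).transpose) i j = -poissonBracket (φ (X i)) (φ (X j)) := by
  simp only [Matrix.mul_apply, Matrix.J, Fintype.sum_sum_type, Matrix.fromBlocks_apply₁₁,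
    Matrix.fromBlocks_apply₁₂, Matrix.fromBlocks_apply₂₁, Matrix.fromBlocks_apply₂₂,
    Matrix.zero_apply, Matrix.neg_apply, Matrix.one_apply, Matrix.transpose_apply,
    jacobianMatrix, poissonBracket]
  simp [Finset.sum_sub_distrib]
  ring

/-- The matrix of Poisson brackets of the variables is `-J`. -/
theorem neg_poissonBracket_X_X {R : Type*} [CommRing R] {n : ℕ} (i j : Fin n ⊕ Fin n) :
    -poissonBracket (X i) (X j) = Matrix.J (Fin n) (MvPolynomial (Fin n ⊕ Fin n) R) i j := by
  rcases i with i | i <;> rcases j with j | j <;>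
    simp [poissonBracket, Matrix.J, pderiv_X, Pi.single_apply, Matrix.one_apply, eq_comm]

/-- The Jacobian matrix of a Poisson endomorphism is symplectic. -/
theorem jacobianMatrix_mem_symplecticGroup {R : Type*} [CommRing R] {n : ℕ}
    (φ : MvPolynomial (Fin n ⊕ Fin n) R →ₐ[R] MvPolynomial (Fin n ⊕ Fin n) R)
    (hpoisson : ∀ f g : MvPolynomial (Fin n ⊕ Fin n) R,
      poissonBracket (φ f) (φ g) = poissonBracket f g) :
    jacobianMatrix φ ∈ Matrix.symplecticGroup (Fin n) (MvPolynomial (Fin n ⊕ Fin n) R) := by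
  rw [SymplecticGroup.mem_iff]
  ext1 i j
  rw [jacobianMatrix_mul_J_mul_transpose_apply, hpoisson, neg_poissonBracket_X_X]

/-- if `n!` is invertible in `R` and `φ` is an endomorphism of the `n`-th
canonical Poisson algebra over `R` (an algebra endomorphism preserving the canonical
Poisson bracket), then `det (Jφ) = 1`. -/
theorem det_jacobian_of_poisson_endomorphism {R : Type*} [CommRing R] {n : ℕ} (hn : 0 < n)
    (hfact : IsUnit ((Nat.factorial n : ℕ) : R))
    (φ : MvPolynomial (Fin n ⊕ Fin n) R →ₐ[R] MvPolynomial (Fin n ⊕ Fin n) R)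
    (hpoisson : ∀ f g : MvPolynomial (Fin n ⊕ Fin n) R,
      poissonBracket (φ f) (φ g) = poissonBracket f g) :
    (jacobianMatrix φ).det = 1 :=
  SymplecticGroup.det_eq_one (jacobianMatrix_mem_symplecticGroup φ hpoisson)
end

section
/- Let K be a field of prime characteristic p and let φ be an endomorphism of the n-th Weyl algebra A_n(K). Let φ_0 be the induced endomorphism of the center Z(A_n(K)) = K[Y_1^p,...,Y_{2n}^p] ≅ K[X_1,...,X_{2n}]. Then deg(φ) = deg(φ_0), where degrees are total degrees of the images of the generators with respect to Y_1,...,Y_{2n} on one side and with the identification X_i = Y_i^p on the other. -/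
/-- The defining relations of the `n`-th Weyl (Dirac quantum) algebra over `R`:
for `i < j`, `Y_i Y_j = Y_j Y_i + δ_{i+n, j}`. -/
inductive WeylRel (R : Type*) [CommRing R] (n : ℕ) :
    FreeAlgebra R (Fin (2 * n)) → FreeAlgebra R (Fin (2 * n)) → Prop
  | comm (i j : Fin (2 * n)) (hij : (i : ℕ) < (j : ℕ)) :
      WeylRel R n (FreeAlgebra.ι R i * FreeAlgebra.ι R j)
        (FreeAlgebra.ι R j * FreeAlgebra.ι R i
          + (if (i : ℕ) + n = (j : ℕ) then 1 else 0))

/-- The `n`-th Weyl (Dirac quantum) algebra over `R`. -/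
abbrev WeylAlgebra (R : Type*) [CommRing R] (n : ℕ) := RingQuot (WeylRel R n)

/-- The canonical generators `Y_1, ..., Y_{2n}` of the Weyl algebra. -/
noncomputable def weylGen (R : Type*) [CommRing R] (n : ℕ) (i : Fin (2 * n)) :
    WeylAlgebra R n :=
  RingQuot.mkAlgHom R (WeylRel R n) (FreeAlgebra.ι R i)

/-- The degree filtration of the Weyl algebra: `weylFil R n d` is the `R`-submodule
spanned by products of at most `d` generators. -/
noncomputable def weylFil (R : Type*) [CommRing R] (n : ℕ) (d : ℕ) :
    Submodule R (WeylAlgebra R n) :=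
  Submodule.span R {x | ∃ l : List (Fin (2 * n)), l.length ≤ d ∧
    x = (l.map (weylGen R n)).prod}

/-- The total degree of an element of the Weyl algebra with respect to the
generators `Y_1, ..., Y_{2n}`. -/
noncomputable def weylDeg {R : Type*} [CommRing R] {n : ℕ} (a : WeylAlgebra R n) : ℕ :=
  sInf {d : ℕ | a ∈ weylFil R n d}

/-- The degree of an algebra endomorphism of the Weyl algebra. -/
noncomputable def weylDegHom {R : Type*} [CommRing R] {n : ℕ}
    (φ : WeylAlgebra R n →ₐ[R] WeylAlgebra R n) : ℕ :=
  Finset.univ.sup fun i : Fin (2 * n) => weylDeg (φ (weylGen R n i))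

open MvPolynomial

theorem MvPolynomial.homogeneousComponent_add_mul {σ R : Type*} [CommSemiring R]
    {f g : MvPolynomial σ R} {d e : ℕ} (hf : f.totalDegree ≤ d) (hg : g.totalDegree ≤ e) :
    homogeneousComponent (d + e) (f * g) =
      homogeneousComponent d f * homogeneousComponent e g := by
  classical
  have vanish : ∀ {h : MvPolynomial σ R} {k : ℕ} {s : σ →₀ ℕ}, h.totalDegree ≤ k →
      k < s.degree → coeff s h = 0 := by
    intro h k s hk hs
    by_contra hne
    exact absurd (le_totalDegree (mem_support_iff.2 hne)) (by
      change ¬ s.degree ≤ _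
      omega)
  ext s
  rw [coeff_homogeneousComponent]
  split_ifs with hs
  · rw [coeff_mul, coeff_mul]
    refine Finset.sum_congr rfl fun x hx => ?_
    have hdeg : x.1.degree + x.2.degree = d + e := by
      rw [← hs, ← Finset.HasAntidiagonal.mem_antidiagonal.1 hx, map_add]
    rw [coeff_homogeneousComponent, coeff_homogeneousComponent]
    split_ifs with h1 h2 h2
    · rfl
    · omega
    · omega
    · rcases lt_or_ge d x.1.degree with h | h
      · rw [vanish hf h]; simp
      · rw [vanish hg (show e < x.2.degree by omega)]; simp
  · exact (((homogeneousComponent_isHomogeneous d f).mul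
      (homogeneousComponent_isHomogeneous e g)).coeff_eq_zero hs).symm

theorem MvPolynomial.totalDegree_mkDerivation_le {σ R : Type*} [CommSemiring R]
    {c : σ → MvPolynomial σ R} (hc : ∀ i, (c i).totalDegree = 0) (f : MvPolynomial σ R) :
    (mkDerivation R c f).totalDegree ≤ f.totalDegree := by
  conv_lhs => rw [f.as_sum, map_sum]
  refine totalDegree_finsetSum_le fun s hs => ?_
  rw [mkDerivation_monomial]
  refine (totalDegree_smul_le _ _).trans (totalDegree_finsetSum_le fun i _ => ?_)
  refine (totalDegree_mul _ _).trans ?_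
  rw [hc, add_zero]
  refine (totalDegree_monomial_le _ _).trans (le_trans ?_ (le_totalDegree hs))
  exact Finsupp.degree_mono tsub_le_self

section WeylAlgebra

variable {R : Type*} [CommRing R] {n : ℕ}

theorem weylGen_mul_weylGen {i j : Fin (2 * n)} (hij : (i : ℕ) < j) :
    weylGen R n i * weylGen R n j =
      weylGen R n j * weylGen R n i + (if (i : ℕ) + n = j then 1 else 0) := by
  have h := RingQuot.mkAlgHom_rel R (WeylRel.comm (R := R) i j hij)
  rw [map_mul, map_add, map_mul] at h
  rw [weylGen, weylGen, h]
  split_ifs <;> simp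

theorem weylGen_commutator (i j : Fin (2 * n)) :
    ∃ c : R, weylGen R n i * weylGen R n j - weylGen R n j * weylGen R n i = c • 1 := by
  rcases lt_trichotomy (i : ℕ) j with h | h | h
  · refine ⟨if (i : ℕ) + n = j then 1 else 0, ?_⟩
    rw [weylGen_mul_weylGen h]
    split_ifs <;> simp
  · exact ⟨0, by rw [Fin.ext h]; simp⟩
  · refine ⟨-(if (j : ℕ) + n = i then 1 else 0), ?_⟩
    rw [weylGen_mul_weylGen h, Algebra.smul_def, map_neg, mul_one]
    split_ifs <;> simp

theorem list_prod_mem_weylFil {l : List (Fin (2 * n))} {d : ℕ} (h : l.length ≤ d) :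
    (l.map (weylGen R n)).prod ∈ weylFil R n d :=
  Submodule.subset_span ⟨l, h, rfl⟩

theorem weylFil_mono {d e : ℕ} (h : d ≤ e) : weylFil R n d ≤ weylFil R n e :=
  Submodule.span_mono fun _ ⟨l, hl, hx⟩ => ⟨l, hl.trans h, hx⟩

theorem one_mem_weylFil (d : ℕ) : (1 : WeylAlgebra R n) ∈ weylFil R n d :=
  list_prod_mem_weylFil (l := []) (Nat.zero_le d)

theorem weylFil_mul_mem {a b : WeylAlgebra R n} {d e : ℕ} (ha : a ∈ weylFil R n d)
    (hb : b ∈ weylFil R n e) : a * b ∈ weylFil R n (d + e) := by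
  have h : a * b ∈ weylFil R n d * weylFil R n e := Submodule.mul_mem_mul ha hb
  rw [weylFil, weylFil, Submodule.span_mul_span] at h
  refine Submodule.span_mono ?_ h
  rintro _ ⟨_, ⟨l, hl, rfl⟩, _, ⟨m, hm, rfl⟩, rfl⟩
  exact ⟨l ++ m, by simp; omega, by simp⟩

theorem weylFil_pow_mem {a : WeylAlgebra R n} {d : ℕ} (ha : a ∈ weylFil R n d) (k : ℕ) :
    a ^ k ∈ weylFil R n (k * d) := by
  induction k with
  | zero => simpa using one_mem_weylFil 0
  | succ k ih =>
    rw [pow_succ, Nat.add_mul k 1 d, Nat.one_mul]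
    exact weylFil_mul_mem ih ha

theorem exists_mem_weylFil (a : WeylAlgebra R n) : ∃ d, a ∈ weylFil R n d := by
  obtain ⟨x, rfl⟩ := RingQuot.mkAlgHom_surjective R (WeylRel R n) a
  induction x using FreeAlgebra.induction with
  | grade0 r =>
    refine ⟨0, ?_⟩
    rw [AlgHom.commutes, Algebra.algebraMap_eq_smul_one]
    exact Submodule.smul_mem _ _ (one_mem_weylFil 0)
  | grade1 i =>
    exact ⟨1, by simpa [weylGen] using list_prod_mem_weylFil (R := R) (l := [i]) le_rfl⟩
  | mul x y hx hy =>
    obtain ⟨d, hd⟩ := hx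
    obtain ⟨e, he⟩ := hy
    exact ⟨d + e, by rw [map_mul]; exact weylFil_mul_mem hd he⟩
  | add x y hx hy =>
    obtain ⟨d, hd⟩ := hx
    obtain ⟨e, he⟩ := hy
    refine ⟨max d e, ?_⟩
    rw [map_add]
    exact Submodule.add_mem _ (weylFil_mono (le_max_left _ _) hd)
      (weylFil_mono (le_max_right _ _) he)

theorem mem_weylFil_weylDeg (a : WeylAlgebra R n) : a ∈ weylFil R n (weylDeg a) :=
  Nat.sInf_mem (exists_mem_weylFil a)

theorem weylDeg_le {a : WeylAlgebra R n} {d : ℕ} (h : a ∈ weylFil R n d) : weylDeg a ≤ d :=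
  Nat.sInf_le h

/-- Permuting the factors of a word changes it only by terms of smaller degree. -/
theorem list_prod_sub_mem_weylFil_of_perm {l m : List (Fin (2 * n))} (h : l.Perm m) :
    ∀ d, l.length ≤ d + 1 →
      (l.map (weylGen R n)).prod - (m.map (weylGen R n)).prod ∈ weylFil R n d := by
  induction h with
  | nil => simp
  | cons i h ih =>
    rename_i l m
    intro d hd
    simp only [List.map_cons, List.prod_cons, ← mul_sub]
    rw [List.length_cons] at hd
    rcases d with _ | d
    · have hl : l = [] := List.eq_nil_of_length_eq_zero (by omega)
      have hm : m = [] := by subst hl; exact h.nil_eq.symm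
      simp [hl, hm]
    · have := weylFil_mul_mem (list_prod_mem_weylFil (R := R) (l := [i]) (d := 1) le_rfl)
        (ih d (by omega))
      rw [add_comm 1 d] at this
      simpa using this
  | swap i j l =>
    intro d hd
    obtain ⟨c, hc⟩ := weylGen_commutator (R := R) j i
    simp only [List.map_cons, List.prod_cons, ← mul_assoc, ← sub_mul, hc, smul_mul_assoc, one_mul]
    simp only [List.length_cons] at hd
    exact Submodule.smul_mem _ _ (list_prod_mem_weylFil (by omega))
  | trans h₁ _ ih₁ ih₂ =>
    intro d hd
    have := Submodule.add_mem _ (ih₁ d hd) (ih₂ d (h₁.length_eq ▸ hd))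
    simpa using this

variable (R n) in
/-- The derivation `∂ / ∂X_{i+n}` for `i < n`, and `0` for `i ≥ n`. -/
noncomputable def weylDerivation (i : Fin (2 * n)) :
    Derivation R (MvPolynomial (Fin (2 * n)) R) (MvPolynomial (Fin (2 * n)) R) :=
  mkDerivation R fun j => if (i : ℕ) + n = j then 1 else 0

theorem weylDerivation_X (i j : Fin (2 * n)) :
    weylDerivation R n i (X j) = if (i : ℕ) + n = j then 1 else 0 :=
  mkDerivation_X _ _ _

theorem weylDerivation_comm (i j : Fin (2 * n)) (f : MvPolynomial (Fin (2 * n)) R) :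
    weylDerivation R n i (weylDerivation R n j f) =
      weylDerivation R n j (weylDerivation R n i f) := by
  have h : ⁅weylDerivation R n i, weylDerivation R n j⁆ = 0 := by
    refine derivation_ext fun k => ?_
    rw [Derivation.commutator_apply, weylDerivation_X, weylDerivation_X]
    split_ifs <;> simp
  have h2 := DFunLike.congr_fun h f
  rw [Derivation.commutator_apply] at h2
  exact sub_eq_zero.1 h2

variable (R n) in
/-- The action of `Y_i` on normally ordered symbols. -/
noncomputable def weylOp (i : Fin (2 * n)) : Module.End R (MvPolynomial (Fin (2 * n)) R) :=
  LinearMap.mulLeft R (X i) + (weylDerivation R n i).toLinearMap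

theorem weylOp_apply (i : Fin (2 * n)) (f : MvPolynomial (Fin (2 * n)) R) :
    weylOp R n i f = X i * f + weylDerivation R n i f := rfl

theorem weylOp_mul_weylOp {i j : Fin (2 * n)} (hij : (i : ℕ) < j) :
    weylOp R n i * weylOp R n j =
      weylOp R n j * weylOp R n i + (if (i : ℕ) + n = j then 1 else 0) := by
  refine LinearMap.ext fun f => ?_
  have hji : ¬ (j : ℕ) + n = i := by omega
  rw [LinearMap.add_apply]
  simp only [Module.End.mul_apply, weylOp_apply, map_add, Derivation.leibniz, weylDerivation_X,
    weylDerivation_comm i j, if_neg hji, smul_eq_mul]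
  split_ifs <;> simp <;> ring

variable (R n) in
/-- The representation of the Weyl algebra by left multiplication on normally ordered symbols. -/
noncomputable def weylRep :
    WeylAlgebra R n →ₐ[R] Module.End R (MvPolynomial (Fin (2 * n)) R) :=
  RingQuot.liftAlgHom R ⟨FreeAlgebra.lift R (weylOp R n), by
    rintro _ _ ⟨i, j, hij⟩
    simp only [map_mul, map_add, FreeAlgebra.lift_ι_apply, weylOp_mul_weylOp hij]
    split_ifs <;> simp⟩

theorem weylRep_weylGen (i : Fin (2 * n)) : weylRep R n (weylGen R n i) = weylOp R n i := by
  rw [weylRep, weylGen, RingQuot.liftAlgHom_mkAlgHom_apply, FreeAlgebra.lift_ι_apply]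

theorem totalDegree_weylDerivation_le (i : Fin (2 * n)) (f : MvPolynomial (Fin (2 * n)) R) :
    (weylDerivation R n i f).totalDegree ≤ f.totalDegree :=
  totalDegree_mkDerivation_le (fun j => by split_ifs <;> simp) f

theorem totalDegree_X_le {σ : Type*} (i : σ) : (X i : MvPolynomial σ R).totalDegree ≤ 1 :=
  (isHomogeneous_X R i).totalDegree_le

theorem totalDegree_weylOp_le (i : Fin (2 * n)) {f : MvPolynomial (Fin (2 * n)) R} {e : ℕ}
    (hf : f.totalDegree ≤ e) : (weylOp R n i f).totalDegree ≤ e + 1 := by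
  rw [weylOp_apply]
  refine (totalDegree_add _ _).trans (max_le ?_ ?_)
  · have := totalDegree_mul (X i) f
    have := totalDegree_X_le (R := R) i
    omega
  · have := totalDegree_weylDerivation_le i f
    omega

theorem homogeneousComponent_weylOp (i : Fin (2 * n)) {f : MvPolynomial (Fin (2 * n)) R} {e : ℕ}
    (hf : f.totalDegree ≤ e) :
    homogeneousComponent (e + 1) (weylOp R n i f) = X i * homogeneousComponent e f := by
  have hD := totalDegree_weylDerivation_le i f
  rw [weylOp_apply, map_add, homogeneousComponent_eq_zero _ _ (Nat.lt_succ_of_le (hD.trans hf)), add_zero,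
    add_comm, homogeneousComponent_add_mul (totalDegree_X_le i) hf,
    homogeneousComponent_eq_self (isHomogeneous_X R i)]

theorem weylRep_list_prod (l : List (Fin (2 * n))) {f : MvPolynomial (Fin (2 * n)) R} {e : ℕ}
    (hf : f.totalDegree ≤ e) :
    (weylRep R n (l.map (weylGen R n)).prod f).totalDegree ≤ l.length + e ∧
      homogeneousComponent (l.length + e) (weylRep R n (l.map (weylGen R n)).prod f) =
        (l.map X).prod * homogeneousComponent e f := by
  induction l with
  | nil => simpa using hf
  | cons i l ih =>
    simp only [List.map_cons, List.prod_cons, map_mul, weylRep_weylGen, Module.End.mul_apply,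
      List.length_cons, Nat.add_right_comm _ 1 e]
    exact ⟨totalDegree_weylOp_le i ih.1, by rw [homogeneousComponent_weylOp i ih.1, ih.2, mul_assoc]⟩

variable (R n) in
/-- The degree-`d` part of the normally ordered symbol; on `weylFil R n d` this is the principal
symbol. -/
noncomputable def weylSymbol (d : ℕ) : WeylAlgebra R n →ₗ[R] MvPolynomial (Fin (2 * n)) R :=
  homogeneousComponent d ∘ₗ LinearMap.applyₗ 1 ∘ₗ (weylRep R n).toLinearMap

theorem weylSymbol_apply (d : ℕ) (a : WeylAlgebra R n) :
    weylSymbol R n d a = homogeneousComponent d (weylRep R n a 1) := rfl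

theorem weylSymbol_list_prod (l : List (Fin (2 * n))) :
    weylSymbol R n l.length (l.map (weylGen R n)).prod = (l.map X).prod := by
  have h := (weylRep_list_prod (R := R) l (f := 1) (e := 0) (by simp)).2
  simpa [weylSymbol_apply] using h

theorem totalDegree_weylRep_le {a : WeylAlgebra R n} {d : ℕ} (ha : a ∈ weylFil R n d)
    {f : MvPolynomial (Fin (2 * n)) R} {e : ℕ} (hf : f.totalDegree ≤ e) :
    (weylRep R n a f).totalDegree ≤ d + e := by
  induction ha using Submodule.span_induction with
  | mem x hx =>
    obtain ⟨l, hl, rfl⟩ := hx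
    have := (weylRep_list_prod l hf).1
    omega
  | zero => simp
  | add x y _ _ hx hy =>
    rw [map_add, LinearMap.add_apply]
    exact (totalDegree_add _ _).trans (max_le hx hy)
  | smul r x _ hx =>
    rw [map_smul, LinearMap.smul_apply]
    exact (totalDegree_smul_le _ _).trans hx

theorem weylSymbol_eq_zero {a : WeylAlgebra R n} {d e : ℕ} (ha : a ∈ weylFil R n d) (h : d < e) :
    weylSymbol R n e a = 0 := by
  have := totalDegree_weylRep_le ha (f := 1) (e := 0) (by simp)
  exact homogeneousComponent_eq_zero e (weylRep R n a 1) (by omega)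

theorem homogeneousComponent_weylRep {a : WeylAlgebra R n} {d : ℕ} (ha : a ∈ weylFil R n d)
    {f : MvPolynomial (Fin (2 * n)) R} {e : ℕ} (hf : f.totalDegree ≤ e) :
    homogeneousComponent (d + e) (weylRep R n a f) =
      weylSymbol R n d a * homogeneousComponent e f := by
  induction ha using Submodule.span_induction with
  | mem x hx =>
    obtain ⟨l, hl, rfl⟩ := hx
    rcases hl.lt_or_eq with h | rfl
    · have := (weylRep_list_prod l hf).1
      rw [weylSymbol_eq_zero (list_prod_mem_weylFil le_rfl) h,
        homogeneousComponent_eq_zero _ _ (by omega), zero_mul]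
    · rw [(weylRep_list_prod l hf).2, weylSymbol_list_prod]
  | zero => simp
  | add x y _ _ hx hy => rw [map_add, LinearMap.add_apply, map_add, map_add, hx, hy, add_mul]
  | smul r x _ hx => rw [map_smul, LinearMap.smul_apply, map_smul, map_smul, hx, smul_mul_assoc]

theorem weylSymbol_mul {a b : WeylAlgebra R n} {d e : ℕ} (ha : a ∈ weylFil R n d)
    (hb : b ∈ weylFil R n e) :
    weylSymbol R n (d + e) (a * b) = weylSymbol R n d a * weylSymbol R n e b := by
  have : (weylRep R n b 1).totalDegree ≤ e := totalDegree_weylRep_le hb (e := 0) (by simp)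
  rw [weylSymbol_apply, map_mul, Module.End.mul_apply, homogeneousComponent_weylRep ha this]
  rfl

theorem weylSymbol_one : weylSymbol R n 0 1 = 1 := by
  simpa using weylSymbol_list_prod (R := R) ([] : List (Fin (2 * n)))

theorem weylSymbol_weylGen (i : Fin (2 * n)) : weylSymbol R n 1 (weylGen R n i) = X i := by
  simpa using weylSymbol_list_prod (R := R) [i]

theorem weylGen_mem_weylFil (i : Fin (2 * n)) : weylGen R n i ∈ weylFil R n 1 := by
  simpa using list_prod_mem_weylFil (R := R) (l := [i]) le_rfl

theorem weylSymbol_pow {a : WeylAlgebra R n} {d : ℕ} (ha : a ∈ weylFil R n d) (k : ℕ) :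
    weylSymbol R n (k * d) (a ^ k) = weylSymbol R n d a ^ k := by
  induction k with
  | zero => simpa using weylSymbol_one
  | succ k ih =>
    rw [pow_succ, Nat.add_mul k 1 d, Nat.one_mul, weylSymbol_mul (weylFil_pow_mem ha k) ha, ih,
      pow_succ]

variable (R n) in
/-- The linear section of the symbol maps sending a monomial to a word in the generators. -/
noncomputable def weylWord : MvPolynomial (Fin (2 * n)) R →ₗ[R] WeylAlgebra R n :=
  (basisMonomials (Fin (2 * n)) R).constr R fun m =>
    ((Finsupp.toMultiset m).toList.map (weylGen R n)).prod

theorem exists_perm_weylWord (l : List (Fin (2 * n))) :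
    ∃ m : List (Fin (2 * n)), l.Perm m ∧
      weylWord R n (l.map X).prod = (m.map (weylGen R n)).prod := by
  classical
  refine ⟨(l : Multiset (Fin (2 * n))).toList, ?_, ?_⟩
  · rw [← Multiset.coe_eq_coe, Multiset.coe_toList]
  · have h : ((l.map X).prod : MvPolynomial (Fin (2 * n)) R) =
        basisMonomials (Fin (2 * n)) R (Multiset.toFinsupp (l : Multiset (Fin (2 * n)))) := by
      rw [coe_basisMonomials]
      induction l with
      | nil => simp
      | cons i l ih =>
        rw [List.map_cons, List.prod_cons, ih, ← Multiset.cons_coe, ← Multiset.singleton_add,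
          map_add, Multiset.toFinsupp_singleton, X, monomial_mul, one_mul]
    rw [weylWord, h, Module.Basis.constr_basis, Multiset.toFinsupp_toMultiset]

theorem sub_weylWord_weylSymbol_mem {a : WeylAlgebra R n} {d : ℕ}
    (ha : a ∈ weylFil R n (d + 1)) :
    a - weylWord R n (weylSymbol R n (d + 1) a) ∈ weylFil R n d := by
  induction ha using Submodule.span_induction with
  | mem x hx =>
    obtain ⟨l, hl, rfl⟩ := hx
    rcases hl.lt_or_eq with h | h
    · rw [weylSymbol_eq_zero (list_prod_mem_weylFil le_rfl) h, map_zero, sub_zero]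
      exact list_prod_mem_weylFil (by omega)
    · rw [← h, weylSymbol_list_prod]
      obtain ⟨m, hm, h2⟩ := exists_perm_weylWord (R := R) l
      rw [h2]
      exact list_prod_sub_mem_weylFil_of_perm hm d hl
  | zero => simp
  | add x y _ _ hx hy =>
    rw [map_add, map_add, add_sub_add_comm]
    exact Submodule.add_mem _ hx hy
  | smul r x _ hx =>
    rw [map_smul, map_smul, ← smul_sub]
    exact Submodule.smul_mem _ _ hx

theorem weylSymbol_weylDeg_ne_zero {a : WeylAlgebra R n} (h : weylDeg a ≠ 0) :
    weylSymbol R n (weylDeg a) a ≠ 0 := by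
  obtain ⟨d, hd⟩ := Nat.exists_eq_succ_of_ne_zero h
  have ha := mem_weylFil_weylDeg a
  rw [hd] at ha ⊢
  intro h0
  have := sub_weylWord_weylSymbol_mem ha
  rw [h0, map_zero, sub_zero] at this
  have := weylDeg_le this
  omega

theorem weylDeg_eq_of_weylSymbol_ne_zero {a : WeylAlgebra R n} {d : ℕ} (ha : a ∈ weylFil R n d)
    (h : weylSymbol R n d a ≠ 0) : weylDeg a = d := by
  refine le_antisymm (weylDeg_le ha) (not_lt.1 fun hlt => h ?_)
  exact weylSymbol_eq_zero (mem_weylFil_weylDeg a) hlt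

theorem weylDeg_pow [IsDomain R] (a : WeylAlgebra R n) (k : ℕ) :
    weylDeg (a ^ k) = k * weylDeg a := by
  have hk := weylFil_pow_mem (mem_weylFil_weylDeg a) k
  by_cases h : weylDeg a = 0
  · have := weylDeg_le hk
    rw [h, mul_zero] at this ⊢
    omega
  · refine weylDeg_eq_of_weylSymbol_ne_zero hk ?_
    rw [weylSymbol_pow (mem_weylFil_weylDeg a)]
    exact pow_ne_zero _ (weylSymbol_weylDeg_ne_zero h)

section PowerMap

variable {p : ℕ} {θ : MvPolynomial (Fin (2 * n)) R →ₐ[R] WeylAlgebra R n}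

theorem map_monomial_mem_weylFil (hθ : ∀ i, θ (X i) = weylGen R n i ^ p)
    (s : Fin (2 * n) →₀ ℕ) :
    θ (monomial s 1) ∈ weylFil R n (p * s.degree) ∧
      weylSymbol R n (p * s.degree) (θ (monomial s 1)) = expand p (monomial s 1) := by
  induction s using Finsupp.induction_linear with
  | zero =>
    have h1 : (monomial 0 1 : MvPolynomial (Fin (2 * n)) R) = 1 := rfl
    simp only [h1, map_one, map_zero, mul_zero]
    exact ⟨one_mem_weylFil 0, weylSymbol_one⟩
  | add s t hs ht =>
    rw [← one_mul (1 : R), ← monomial_mul, map_mul θ, map_mul (expand p), map_add, mul_add,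
      weylSymbol_mul hs.1 ht.1, hs.2, ht.2]
    exact ⟨weylFil_mul_mem hs.1 ht.1, rfl⟩
  | single i k =>
    have hi : weylGen R n i ^ p ∈ weylFil R n p := by
      simpa using weylFil_pow_mem (weylGen_mem_weylFil i) p
    have hsymb := weylSymbol_pow (weylGen_mem_weylFil (R := R) i) p
    rw [mul_one, weylSymbol_weylGen] at hsymb
    rw [← X_pow_eq_monomial, map_pow θ, map_pow (expand p), hθ, Finsupp.degree_single, mul_comm p k,
      weylSymbol_pow hi, hsymb, expand_X]
    exact ⟨weylFil_pow_mem hi k, rfl⟩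

theorem map_mem_weylFil (hθ : ∀ i, θ (X i) = weylGen R n i ^ p)
    {f : MvPolynomial (Fin (2 * n)) R} {d : ℕ} (hf : f.totalDegree ≤ d) :
    θ f ∈ weylFil R n (p * d) := by
  rw [f.as_sum, map_sum]
  refine Submodule.sum_mem _ fun s hs => ?_
  have hsmul : monomial s (coeff s f) = coeff s f • monomial s (1 : R) := by
    rw [smul_monomial, smul_eq_mul, mul_one]
  rw [hsmul, map_smul]
  refine Submodule.smul_mem _ _ (weylFil_mono ?_ (map_monomial_mem_weylFil hθ s).1)
  exact Nat.mul_le_mul_left p ((le_totalDegree hs).trans hf)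

theorem weylSymbol_map (hp : 0 < p) (hθ : ∀ i, θ (X i) = weylGen R n i ^ p)
    {f : MvPolynomial (Fin (2 * n)) R} {d : ℕ} (hf : f.totalDegree ≤ d) :
    weylSymbol R n (p * d) (θ f) = expand p (homogeneousComponent d f) := by
  rw [f.as_sum]
  simp only [map_sum]
  refine Finset.sum_congr rfl fun s hs => ?_
  have hsmul : monomial s (coeff s f) = coeff s f • monomial s (1 : R) := by
    rw [smul_monomial, smul_eq_mul, mul_one]
  rw [hsmul]
  simp only [map_smul]
  congr 1
  have hle : s.degree ≤ d := (le_totalDegree hs).trans hf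
  have hs := map_monomial_mem_weylFil hθ s
  have hmon : (monomial s (1 : R)).IsHomogeneous s.degree := isHomogeneous_monomial 1 rfl
  rw [homogeneousComponent_of_mem hmon]
  split_ifs with h
  · rw [h, hs.2]
  · rw [map_zero]
    exact weylSymbol_eq_zero hs.1 (Nat.mul_lt_mul_of_pos_left (by omega) hp)

theorem homogeneousComponent_totalDegree_ne_zero {σ : Type*} {f : MvPolynomial σ R}
    (h : f.totalDegree ≠ 0) : homogeneousComponent f.totalDegree f ≠ 0 := by
  have hf : f.support.Nonempty := by
    rw [support_nonempty]
    rintro rfl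
    simp at h
  obtain ⟨s, hs, hdeg⟩ := Finset.exists_mem_eq_sup f.support hf fun s => s.sum fun _ e => e
  intro h0
  have := congrArg (coeff s) h0
  rw [coeff_homogeneousComponent, if_pos (show s.degree = f.totalDegree from hdeg.symm), coeff_zero] at this
  exact mem_support_iff.1 hs this

theorem weylDeg_map (hp : 0 < p) (hθ : ∀ i, θ (X i) = weylGen R n i ^ p)
    (f : MvPolynomial (Fin (2 * n)) R) : weylDeg (θ f) = p * f.totalDegree := by
  have hmem := map_mem_weylFil hθ (le_refl f.totalDegree)
  by_cases h : f.totalDegree = 0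
  · have := weylDeg_le hmem
    rw [h, mul_zero] at this ⊢
    omega
  · refine weylDeg_eq_of_weylSymbol_ne_zero hmem ?_
    rw [weylSymbol_map hp hθ le_rfl, expand_ne_zero hp]
    exact homogeneousComponent_totalDegree_ne_zero h

end PowerMap

end WeylAlgebra

/-- for an endomorphism `φ` of the `n`-th Weyl algebra over a field of
characteristic `p > 0`, inducing the endomorphism `φ₀ = ψ` of the center
`K[Y_1^p,...,Y_{2n}^p] ≅ K[X_1,...,X_{2n}]` (the identification `θ` sends `X_i` to
`Y_i^p`), one has `deg φ = deg φ₀`. -/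
theorem weyl_endomorphism_deg_eq_center_deg
    {K : Type*} [Field K] (p : ℕ) [Fact p.Prime] [CharP K p] {n : ℕ} (hn : 0 < n)
    (φ : WeylAlgebra K n →ₐ[K] WeylAlgebra K n)
    (θ : MvPolynomial (Fin (2 * n)) K →ₐ[K] WeylAlgebra K n)
    (hθ : ∀ i : Fin (2 * n), θ (X i) = weylGen K n i ^ p)
    (ψ : MvPolynomial (Fin (2 * n)) K →ₐ[K] MvPolynomial (Fin (2 * n)) K)
    (hψ : ∀ i : Fin (2 * n), θ (ψ (X i)) = φ (θ (X i))) :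
    weylDegHom φ = Finset.univ.sup fun i : Fin (2 * n) => (ψ (X i)).totalDegree := by
  have hp : 0 < p := (Fact.out : p.Prime).pos
  refine Finset.sup_congr rfl fun i _ => Nat.eq_of_mul_eq_mul_left hp ?_
  rw [← weylDeg_pow, ← map_pow, ← hθ, ← hψ, weylDeg_map hp hθ]
end

section
/- Let R be a commutative domain and φ an automorphism of the n-th Weyl algebra A_n(R). Then deg(φ^{-1}) ≤ deg(φ)^{2n−1}, where deg(ψ) = max_{1≤i≤2n} deg(ψ(Y_i)) with respect to the total degree in the generators Y_1,...,Y_{2n}. -/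
/-- The degree of an algebra automorphism of the Weyl algebra. -/
noncomputable def weylDegEquiv {R : Type*} [CommRing R] {n : ℕ}
    (φ : WeylAlgebra R n ≃ₐ[R] WeylAlgebra R n) : ℕ :=
  Finset.univ.sup fun i : Fin (2 * n) => weylDeg (φ (weylGen R n i))

namespace WeylAlgebra

variable {R : Type*} [CommRing R] {n : ℕ}

/-! ### The degree filtration -/

/-- The product of a list of generators. -/
noncomputable def word (R : Type*) [CommRing R] (n : ℕ) (l : List (Fin (2 * n))) :
    WeylAlgebra R n :=
  (l.map (weylGen R n)).prod

@[simp] lemma word_nil : word R n [] = 1 := by simp [word]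

@[simp] lemma word_cons (i : Fin (2 * n)) (l : List (Fin (2 * n))) :
    word R n (i :: l) = weylGen R n i * word R n l := by simp [word]

lemma word_append (l l' : List (Fin (2 * n))) :
    word R n (l ++ l') = word R n l * word R n l' := by simp [word]

lemma word_mem_weylFil {l : List (Fin (2 * n))} {d : ℕ} (h : l.length ≤ d) :
    word R n l ∈ weylFil R n d :=
  Submodule.subset_span ⟨l, h, rfl⟩

lemma weylFil_le_iff {d : ℕ} {S : Submodule R (WeylAlgebra R n)} :
    weylFil R n d ≤ S ↔ ∀ l : List (Fin (2 * n)), l.length ≤ d → word R n l ∈ S := by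
  refine ⟨fun h l hl => h (word_mem_weylFil hl), fun h => Submodule.span_le.2 ?_⟩
  rintro _ ⟨l, hl, rfl⟩
  exact h l hl

lemma weylFil_mono {d e : ℕ} (h : d ≤ e) : weylFil R n d ≤ weylFil R n e :=
  weylFil_le_iff.2 fun _ hl => word_mem_weylFil (hl.trans h)

lemma mul_mem_weylFil {a b : WeylAlgebra R n} {d e : ℕ} (ha : a ∈ weylFil R n d)
    (hb : b ∈ weylFil R n e) : a * b ∈ weylFil R n (d + e) := by
  have h1 : ∀ l : List (Fin (2 * n)), l.length ≤ d → word R n l * b ∈ weylFil R n (d + e) := by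
    intro l hl
    suffices weylFil R n e ≤ (weylFil R n (d + e)).comap (LinearMap.mulLeft R (word R n l)) from
      this hb
    refine weylFil_le_iff.2 fun l' hl' => ?_
    simp only [Submodule.mem_comap, LinearMap.mulLeft_apply, ← word_append]
    exact word_mem_weylFil (by simp; omega)
  suffices weylFil R n d ≤ (weylFil R n (d + e)).comap (LinearMap.mulRight R b) from this ha
  exact weylFil_le_iff.2 h1

lemma weylGen_mem_weylFil (i : Fin (2 * n)) : weylGen R n i ∈ weylFil R n 1 := by
  simpa using word_mem_weylFil (R := R) (l := [i]) (d := 1) (by simp)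

lemma exists_mem_weylFil (a : WeylAlgebra R n) : ∃ d, a ∈ weylFil R n d := by
  obtain ⟨x, rfl⟩ := RingQuot.mkAlgHom_surjective R (WeylRel R n) a
  induction x using FreeAlgebra.induction with
  | grade0 r =>
    refine ⟨0, ?_⟩
    rw [AlgHom.commutes, Algebra.algebraMap_eq_smul_one]
    exact Submodule.smul_mem _ _ (by simpa using word_mem_weylFil (R := R) (n := n) (l := []) le_rfl)
  | grade1 i => exact ⟨1, weylGen_mem_weylFil i⟩
  | mul x y hx hy =>
    obtain ⟨d, hd⟩ := hx
    obtain ⟨e, he⟩ := hy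
    exact ⟨d + e, by rw [map_mul]; exact mul_mem_weylFil hd he⟩
  | add x y hx hy =>
    obtain ⟨d, hd⟩ := hx
    obtain ⟨e, he⟩ := hy
    refine ⟨d + e, ?_⟩
    rw [map_add]
    exact add_mem (weylFil_mono (by omega) hd) (weylFil_mono (by omega) he)

lemma mem_weylFil_weylDeg (a : WeylAlgebra R n) : a ∈ weylFil R n (weylDeg a) :=
  Nat.sInf_mem (s := {d : ℕ | a ∈ weylFil R n d}) (exists_mem_weylFil a)

lemma notMem_weylFil_of_lt_weylDeg {a : WeylAlgebra R n} {d : ℕ} (h : d < weylDeg a) :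
    a ∉ weylFil R n d :=
  Nat.notMem_of_lt_sInf (s := {d : ℕ | a ∈ weylFil R n d}) h

instance finite_weylFil (d : ℕ) : Module.Finite R (weylFil R n d) := by
  refine Module.Finite.span_of_finite R (((List.finite_length_le (Fin (2 * n)) d).image
    (word R n)).subset ?_)
  rintro _ ⟨l, hl, rfl⟩
  exact ⟨l, hl, rfl⟩

/-! ### Reordering words -/

lemma exists_commutator_weylGen (i j : Fin (2 * n)) :
    ∃ c : R, weylGen R n i * weylGen R n j - weylGen R n j * weylGen R n i = c • 1 := by
  have key : ∀ i j : Fin (2 * n), (i : ℕ) < j → weylGen R n i * weylGen R n j =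
      weylGen R n j * weylGen R n i + if (i : ℕ) + n = j then 1 else 0 := by
    intro i j h
    have := RingQuot.mkAlgHom_rel R (WeylRel.comm (R := R) i j h)
    rw [map_mul, map_add, map_mul] at this
    rw [weylGen, weylGen, this]
    split_ifs <;> simp
  rcases lt_trichotomy (i : ℕ) j with h | h | h
  · rw [key i j h]
    exact ⟨if (i : ℕ) + n = j then 1 else 0, by split_ifs <;> simp⟩
  · rw [Fin.ext h]
    exact ⟨0, by simp⟩
  · rw [key j i h]
    refine ⟨-if (j : ℕ) + n = i then 1 else 0, ?_⟩
    rw [sub_add_cancel_left]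
    split_ifs
    · have := neg_smul (1 : R) (1 : WeylAlgebra R n)
      rw [one_smul] at this
      exact this.symm
    · simp

lemma word_sub_word_mem_of_perm {l l' : List (Fin (2 * n))} (h : l.Perm l') :
    ∀ d, l.length ≤ d + 1 → word R n l - word R n l' ∈ weylFil R n d := by
  induction h with
  | nil => intro d _; simp
  | @cons x l₁ l₂ h ih =>
    intro d hd
    rw [word_cons, word_cons, ← mul_sub]
    rcases d with _ | d
    · have h1 : l₁ = [] := List.length_eq_zero_iff.1 (by simpa using hd)
      subst h1
      rw [h.nil_eq]
      simp
    · rw [add_comm d 1]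
      exact mul_mem_weylFil (weylGen_mem_weylFil x) (ih d (by simpa using hd))
  | swap x y l =>
    intro d hd
    obtain ⟨c, hc⟩ := exists_commutator_weylGen (R := R) y x
    have : word R n (y :: x :: l) - word R n (x :: y :: l) = c • word R n l := by
      simp only [word_cons, ← mul_assoc]
      rw [← sub_mul, hc, smul_mul_assoc, one_mul]
    rw [this]
    exact Submodule.smul_mem _ _ (word_mem_weylFil (by simp at hd; omega))
  | trans h₁ h₂ ih₁ ih₂ =>
    intro d hd
    have := add_mem (ih₁ d hd) (ih₂ d (h₁.length_eq ▸ hd))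
    simpa using this

/-! ### The polynomial representation and principal symbols -/

/-- The derivation `∂ / ∂X_{i+n}` of the polynomial ring, or `0` if `i + n` is out of range. -/
noncomputable def dual (R : Type*) [CommRing R] {n : ℕ} (i : Fin (2 * n)) :
    Derivation R (MvPolynomial (Fin (2 * n)) R) (MvPolynomial (Fin (2 * n)) R) :=
  if h : (i : ℕ) + n < 2 * n then MvPolynomial.pderiv ⟨i + n, h⟩ else 0

lemma dual_X (i j : Fin (2 * n)) :
    dual R i (MvPolynomial.X j) = if (i : ℕ) + n = j then 1 else 0 := by
  unfold dual
  split_ifs with h h' h'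
  · rw [show (⟨i + n, h⟩ : Fin (2 * n)) = j from Fin.ext h', MvPolynomial.pderiv_X_self]
  · exact MvPolynomial.pderiv_X_of_ne fun hj => h' (by rw [hj])
  · exact absurd j.2 (by omega)
  · simp

lemma dual_comm (i j : Fin (2 * n)) (f : MvPolynomial (Fin (2 * n)) R) :
    dual R i (dual R j f) = dual R j (dual R i f) := by
  have : ⁅dual R i, dual R j⁆ = 0 := by
    refine MvPolynomial.derivation_ext fun k => ?_
    rw [Derivation.commutator_apply, dual_X, dual_X]
    split_ifs <;> simp
  have h := congrArg (fun D => D f) this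
  simpa [Derivation.commutator_apply, sub_eq_zero] using h

lemma totalDegree_dual_le (i : Fin (2 * n)) (f : MvPolynomial (Fin (2 * n)) R) :
    (dual R i f).totalDegree ≤ f.totalDegree := by
  unfold dual
  split_ifs with h
  · conv_lhs => rw [← MvPolynomial.sum_homogeneousComponent f, map_sum]
    refine MvPolynomial.totalDegree_finsetSum_le fun k hk => ?_
    have := ((MvPolynomial.homogeneousComponent_isHomogeneous k f).pderiv
      (i := ⟨i + n, h⟩)).totalDegree_le
    have := Finset.mem_range.1 hk
    omega
  · simp

/-- The operator by which a generator acts on polynomials. -/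
noncomputable def polyOp (R : Type*) [CommRing R] {n : ℕ} (i : Fin (2 * n)) :
    Module.End R (MvPolynomial (Fin (2 * n)) R) :=
  LinearMap.mulLeft R (MvPolynomial.X i) + (dual R i).toLinearMap

lemma polyOp_apply (i : Fin (2 * n)) (f : MvPolynomial (Fin (2 * n)) R) :
    polyOp R i f = MvPolynomial.X i * f + dual R i f := rfl

/-- The left regular representation of the Weyl algebra, read on polynomials. -/
noncomputable def polyRep (R : Type*) [CommRing R] (n : ℕ) :
    WeylAlgebra R n →ₐ[R] Module.End R (MvPolynomial (Fin (2 * n)) R) :=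
  RingQuot.liftAlgHom R ⟨FreeAlgebra.lift R (polyOp R), by
    rintro _ _ ⟨i, j, hij⟩
    ext1 s
    have hc : FreeAlgebra.lift R (polyOp R (n := n)) (if (i : ℕ) + n = j then 1 else 0) =
        if (i : ℕ) + n = j then 1 else 0 := by split_ifs <;> simp
    rw [map_mul, map_add, map_mul, hc, FreeAlgebra.lift_ι_apply, FreeAlgebra.lift_ι_apply]
    ext1
    simp only [LinearMap.comp_apply, LinearMap.add_apply, Module.End.mul_apply, polyOp_apply,
      map_add, Derivation.leibniz, smul_eq_mul, dual_X, dual_comm i j]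
    have hne : ¬ (j : ℕ) + n = i := by omega
    rw [if_neg hne]
    split_ifs <;> simp <;> ring⟩

lemma polyRep_weylGen (i : Fin (2 * n)) : polyRep R n (weylGen R n i) = polyOp R i := by
  simp [polyRep, weylGen]

lemma homogeneousComponent_X_mul {σ : Type*} (i : σ) (d : ℕ) (f : MvPolynomial σ R) :
    MvPolynomial.homogeneousComponent (d + 1) (MvPolynomial.X i * f) =
      MvPolynomial.X i * MvPolynomial.homogeneousComponent d f := by
  classical
  ext s
  rw [MvPolynomial.coeff_homogeneousComponent, MvPolynomial.coeff_X_mul',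
    MvPolynomial.coeff_X_mul', MvPolynomial.coeff_homogeneousComponent]
  by_cases hs : i ∈ s.support
  · have h1 : Finsupp.single i 1 ≤ s := by
      rw [Finsupp.single_le_iff]
      exact Nat.one_le_iff_ne_zero.2 (Finsupp.mem_support_iff.1 hs)
    have h2 : (s - Finsupp.single i 1).degree + 1 = s.degree := by
      conv_rhs => rw [← tsub_add_cancel_of_le h1, map_add, Finsupp.degree_single]
    simp only [hs, if_true]
    exact if_congr (by omega) rfl rfl
  · simp [hs]

lemma totalDegree_polyOp_le {i : Fin (2 * n)} {f : MvPolynomial (Fin (2 * n)) R} {d : ℕ}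
    (hf : f.totalDegree ≤ d) : (polyOp R i f).totalDegree ≤ d + 1 := by
  rw [polyOp_apply]
  refine (MvPolynomial.totalDegree_add _ _).trans (max_le ?_ ?_)
  · refine (MvPolynomial.totalDegree_mul _ _).trans ?_
    have : (MvPolynomial.X i : MvPolynomial (Fin (2 * n)) R).totalDegree ≤ 1 :=
      (MvPolynomial.isHomogeneous_X R i).totalDegree_le
    omega
  · exact (totalDegree_dual_le i f).trans (by omega)

lemma homogeneousComponent_polyOp {i : Fin (2 * n)} {f : MvPolynomial (Fin (2 * n)) R} {d : ℕ}
    (hf : f.totalDegree ≤ d) :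
    MvPolynomial.homogeneousComponent (d + 1) (polyOp R i f) =
      MvPolynomial.X i * MvPolynomial.homogeneousComponent d f := by
  rw [polyOp_apply, map_add, homogeneousComponent_X_mul,
    MvPolynomial.homogeneousComponent_eq_zero _ (dual R i f), add_zero]
  exact Nat.lt_succ_of_le ((totalDegree_dual_le i f).trans hf)

lemma polyRep_word (l : List (Fin (2 * n))) {f : MvPolynomial (Fin (2 * n)) R} {e : ℕ}
    (hf : f.totalDegree ≤ e) :
    (polyRep R n (word R n l) f).totalDegree ≤ l.length + e ∧
      MvPolynomial.homogeneousComponent (l.length + e) (polyRep R n (word R n l) f) =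
        (l.map MvPolynomial.X).prod * MvPolynomial.homogeneousComponent e f := by
  induction l with
  | nil => simpa using hf
  | cons i l ih =>
    rw [word_cons, map_mul, Module.End.mul_apply, polyRep_weylGen, List.length_cons,
      add_right_comm, homogeneousComponent_polyOp ih.1, ih.2, List.map_cons, List.prod_cons,
      mul_assoc]
    exact ⟨totalDegree_polyOp_le ih.1, rfl⟩

/-- The polynomial attached to an element of the Weyl algebra. -/
noncomputable def toPoly (R : Type*) [CommRing R] (n : ℕ) :
    WeylAlgebra R n →ₗ[R] MvPolynomial (Fin (2 * n)) R :=
  (LinearMap.applyₗ 1).comp (polyRep R n).toLinearMap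

lemma toPoly_apply (a : WeylAlgebra R n) : toPoly R n a = polyRep R n a 1 := rfl

/-- The degree `d` principal symbol of an element of the `d`-th step of the filtration. -/
noncomputable def symbol (R : Type*) [CommRing R] (n d : ℕ) :
    WeylAlgebra R n →ₗ[R] MvPolynomial (Fin (2 * n)) R :=
  (MvPolynomial.homogeneousComponent d).comp (toPoly R n)

lemma symbol_apply (d : ℕ) (a : WeylAlgebra R n) :
    symbol R n d a = MvPolynomial.homogeneousComponent d (polyRep R n a 1) := rfl

lemma symbol_word (l : List (Fin (2 * n))) :
    symbol R n l.length (word R n l) = (l.map MvPolynomial.X).prod := by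
  have := (polyRep_word (R := R) l (f := 1) (e := 0) (by simp)).2
  simpa [symbol_apply, MvPolynomial.homogeneousComponent_zero] using this

lemma symbol_word_of_lt {l : List (Fin (2 * n))} {d : ℕ} (h : l.length < d) :
    symbol R n d (word R n l) = 0 :=
  MvPolynomial.homogeneousComponent_eq_zero _ _
    ((polyRep_word (R := R) l (f := 1) (e := 0) (by simp)).1.trans_lt h)

lemma symbol_eq_zero_of_mem {a : WeylAlgebra R n} {d e : ℕ} (h : a ∈ weylFil R n d) (hde : d < e) :
    symbol R n e a = 0 := by
  suffices weylFil R n d ≤ LinearMap.ker (symbol R n e) from this h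
  exact weylFil_le_iff.2 fun l hl => symbol_word_of_lt (by omega)

lemma totalDegree_toPoly_le {a : WeylAlgebra R n} {d : ℕ} (h : a ∈ weylFil R n d) :
    (toPoly R n a).totalDegree ≤ d := by
  suffices weylFil R n d ≤ (MvPolynomial.restrictTotalDegree (Fin (2 * n)) R d).comap
      (toPoly R n) from
    (MvPolynomial.mem_restrictTotalDegree _ _ _).1 (this h)
  refine weylFil_le_iff.2 fun l hl => ?_
  rw [Submodule.mem_comap, MvPolynomial.mem_restrictTotalDegree]
  exact (polyRep_word (R := R) l (f := 1) (e := 0) (by simp)).1.trans hl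

lemma symbol_mul {a b : WeylAlgebra R n} {d e : ℕ} (ha : a ∈ weylFil R n d)
    (hb : b ∈ weylFil R n e) :
    symbol R n (d + e) (a * b) = symbol R n d a * symbol R n e b := by
  suffices weylFil R n d ≤ LinearMap.ker ((symbol R n (d + e)).comp (LinearMap.mulRight R b) -
      (LinearMap.mulRight R (symbol R n e b)).comp (symbol R n d)) by
    have := this ha
    rwa [LinearMap.mem_ker, LinearMap.sub_apply, sub_eq_zero] at this
  refine weylFil_le_iff.2 fun l hl => ?_
  rw [LinearMap.mem_ker, LinearMap.sub_apply, sub_eq_zero]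
  simp only [LinearMap.comp_apply, LinearMap.mulRight_apply]
  have hw := polyRep_word (R := R) l (totalDegree_toPoly_le hb)
  rw [symbol_apply, map_mul, Module.End.mul_apply, ← toPoly_apply b]
  rcases hl.lt_or_eq with hl | rfl
  · rw [symbol_word_of_lt hl, zero_mul, MvPolynomial.homogeneousComponent_eq_zero]
    exact hw.1.trans_lt (by omega)
  · rw [hw.2, symbol_word]
    rfl

/-- A linear choice of an ordered word for every monomial. -/
noncomputable def quantize (R : Type*) [CommRing R] (n : ℕ) :
    MvPolynomial (Fin (2 * n)) R →ₗ[R] WeylAlgebra R n :=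
  (MvPolynomial.basisMonomials (Fin (2 * n)) R).constr R
    fun s => word R n (Finsupp.toMultiset s).toList

lemma prod_map_X {σ : Type*} [DecidableEq σ] (l : List σ) :
    (l.map (MvPolynomial.X (R := R))).prod =
      MvPolynomial.monomial (Multiset.toFinsupp (l : Multiset σ)) 1 := by
  induction l with
  | nil => simp
  | cons i l ih =>
    rw [List.map_cons, List.prod_cons, ih, ← Multiset.cons_coe, ← Multiset.singleton_add,
      map_add, Multiset.toFinsupp_singleton, MvPolynomial.X, MvPolynomial.monomial_mul, one_mul]

lemma quantize_monomial (s : Fin (2 * n) →₀ ℕ) :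
    quantize R n (MvPolynomial.monomial s 1) = word R n (Finsupp.toMultiset s).toList := by
  have := (MvPolynomial.basisMonomials (Fin (2 * n)) R).constr_basis R
    (fun s => word R n (Finsupp.toMultiset s).toList) s
  rwa [MvPolynomial.coe_basisMonomials] at this

lemma sub_quantize_symbol_mem {a : WeylAlgebra R n} {d : ℕ} (h : a ∈ weylFil R n (d + 1)) :
    a - quantize R n (symbol R n (d + 1) a) ∈ weylFil R n d := by
  suffices weylFil R n (d + 1) ≤ (weylFil R n d).comap
      (LinearMap.id - (quantize R n).comp (symbol R n (d + 1))) from this h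
  refine weylFil_le_iff.2 fun l hl => ?_
  rw [Submodule.mem_comap]
  simp only [LinearMap.sub_apply, LinearMap.id_apply, LinearMap.comp_apply]
  rcases hl.lt_or_eq with hl | hl
  · rw [symbol_word_of_lt hl, map_zero, sub_zero]
    exact word_mem_weylFil (by omega)
  · rw [← hl, symbol_word, prod_map_X, quantize_monomial, Multiset.toFinsupp_toMultiset]
    refine word_sub_word_mem_of_perm ?_ d hl.le
    rw [← Multiset.coe_eq_coe, Multiset.coe_toList]

lemma mem_weylFil_of_symbol_eq_zero {a : WeylAlgebra R n} {d : ℕ} (h : a ∈ weylFil R n (d + 1))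
    (h0 : symbol R n (d + 1) a = 0) : a ∈ weylFil R n d := by
  simpa [h0] using sub_quantize_symbol_mem h

lemma symbol_weylDeg_ne_zero {a : WeylAlgebra R n} (h : weylDeg a ≠ 0) :
    symbol R n (weylDeg a) a ≠ 0 := by
  obtain ⟨d, hd⟩ := Nat.exists_eq_succ_of_ne_zero h
  intro h0
  have ha := mem_weylFil_weylDeg a
  rw [hd] at ha h0
  exact notMem_weylFil_of_lt_weylDeg (by omega) (mem_weylFil_of_symbol_eq_zero ha h0)

lemma weylDeg_add_le_of_mul_mem [IsDomain R] {a b : WeylAlgebra R n} {d : ℕ} (hb : weylDeg b ≠ 0)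
    (hbd : weylDeg b ≤ d) (h : a * b ∈ weylFil R n d) : weylDeg a + weylDeg b ≤ d := by
  by_cases ha : weylDeg a = 0
  · omega
  by_contra! hlt
  refine mul_ne_zero (symbol_weylDeg_ne_zero ha) (symbol_weylDeg_ne_zero hb) ?_
  rw [← symbol_mul (mem_weylFil_weylDeg a) (mem_weylFil_weylDeg b)]
  exact symbol_eq_zero_of_mem h hlt

lemma map_mem_weylFil (φ : WeylAlgebra R n ≃ₐ[R] WeylAlgebra R n) {a : WeylAlgebra R n} {d : ℕ}
    (ha : a ∈ weylFil R n d) : φ a ∈ weylFil R n (weylDegEquiv φ * d) := by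
  suffices weylFil R n d ≤ (weylFil R n (weylDegEquiv φ * d)).comap φ.toLinearMap from this ha
  refine weylFil_le_iff.2 fun l hl => ?_
  suffices φ (word R n l) ∈ weylFil R n (weylDegEquiv φ * l.length) from
    weylFil_mono (Nat.mul_le_mul_left _ hl) this
  clear hl
  induction l with
  | nil => simpa using word_mem_weylFil (R := R) (n := n) (l := []) le_rfl
  | cons i l ih =>
    rw [word_cons, map_mul, List.length_cons, Nat.mul_succ, add_comm]
    refine mul_mem_weylFil (weylFil_mono ?_ (mem_weylFil_weylDeg _)) ih
    exact Finset.le_sup (f := fun i => weylDeg (φ (weylGen R n i))) (Finset.mem_univ i)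

/-! ### Growth estimates -/

lemma card_sym_fin_succ (k a : ℕ) : Fintype.card (Sym (Fin (k + 1)) a) = (a + k).choose k := by
  rw [Sym.card_sym_eq_choose, Fintype.card_fin, Nat.add_right_comm, Nat.add_sub_cancel,
    Nat.add_comm k a, Nat.choose_symm_add]

lemma card_sym_fin_mono {m : ℕ} (hm : 0 < m) {a b : ℕ} (h : a ≤ b) :
    Fintype.card (Sym (Fin m) a) ≤ Fintype.card (Sym (Fin m) b) := by
  obtain ⟨k, rfl⟩ := Nat.exists_eq_succ_of_ne_zero hm.ne'
  rw [card_sym_fin_succ, card_sym_fin_succ]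
  exact Nat.choose_le_choose k (by omega)

lemma mul_pow_le_of_mul_card_sym_le {k e a b : ℕ}
    (h : e * Fintype.card (Sym (Fin (k + 1)) a) ≤ Fintype.card (Sym (Fin (k + 1)) b)) :
    e * (a + 1) ^ k ≤ (b + k) ^ k := by
  rw [card_sym_fin_succ, card_sym_fin_succ] at h
  have h1 := Nat.pow_le_choose (α := ℝ) k (a + k)
  have h2 := Nat.choose_le_pow_div (α := ℝ) k (b + k)
  rw [show a + k + 1 - k = a + 1 by omega] at h1
  have h3 : (e : ℝ) * (a + k).choose k ≤ (b + k).choose k := by exact_mod_cast h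
  have h4 : (0 : ℝ) < k.factorial := by exact_mod_cast k.factorial_pos
  rw [div_le_iff₀ h4] at h1
  rw [le_div_iff₀ h4] at h2
  have h5 : (e : ℝ) * ((a + 1 : ℕ) : ℝ) ^ k ≤ ((b + k : ℕ) : ℝ) ^ k :=
    calc (e : ℝ) * ((a + 1 : ℕ) : ℝ) ^ k ≤ e * ((a + k).choose k * k.factorial) := by gcongr
      _ = e * (a + k).choose k * k.factorial := by ring
      _ ≤ (b + k).choose k * k.factorial := by gcongr
      _ ≤ _ := h2
  exact_mod_cast h5

lemma le_pow_of_forall_mul_pow_le {k d e : ℕ}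
    (h : ∀ a : ℕ, e * (a + 1) ^ k ≤ (d * (a + e) + k) ^ k) : e ≤ d ^ k := by
  open Filter Topology in
  have hlim : Tendsto (fun a : ℕ => ((d : ℝ) + (d * (e - 1) + k) * (1 / ((a : ℝ) + 1))) ^ k) atTop
      (𝓝 ((d + (d * (e - 1) + k) * 0) ^ k)) :=
    ((tendsto_one_div_add_atTop_nhds_zero_nat.const_mul _).const_add _).pow k
  have hle : (e : ℝ) ≤ (d + (d * (e - 1) + k) * 0) ^ k := by
    refine ge_of_tendsto' hlim fun a => ?_
    have ha : (0 : ℝ) < (a : ℝ) + 1 := by positivity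
    have h1 : (e : ℝ) * ((a : ℝ) + 1) ^ k ≤ (d * (a + e) + k) ^ k := by exact_mod_cast h a
    have h2 : (d : ℝ) + (d * (e - 1) + k) * (1 / ((a : ℝ) + 1)) =
        (d * (a + e) + k) / ((a : ℝ) + 1) := by
      field_simp
      ring
    rwa [h2, div_pow, le_div_iff₀ (by positivity)]
  rw [mul_zero, add_zero] at hle
  exact_mod_cast hle

/-! ### Ranks of the filtration steps -/

section Rank

open Module

variable [IsDomain R]

lemma finrank_range_add_finrank_ker {M N : Type*} [AddCommMonoid M] [Module R M]
    [Module.Finite R M] [AddCommMonoid N] [Module R N] (f : M →ₗ[R] N) :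
    finrank R (LinearMap.range f) + finrank R (LinearMap.ker f) = finrank R M := by
  let _ := Module.addCommMonoidToAddCommGroup R (M := M)
  let _ := Module.addCommMonoidToAddCommGroup R (M := N)
  rw [← f.quotKerEquivRange.finrank_eq, finrank, finrank, finrank,
    ← rank_quotient_add_rank_of_isDomain (LinearMap.ker f), Cardinal.toNat_add (rank_lt_aleph0 R _)
    ((Submodule.rank_le _).trans_lt (rank_lt_aleph0 R M))]

lemma finrank_add_finrank_range_le {M N : Type*} [AddCommMonoid M] [Module R M]
    [Module.Finite R M] [AddCommMonoid N] [Module R N] (f : M →ₗ[R] N) {S : Submodule R M}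
    (h : S ≤ LinearMap.ker f) :
    finrank R S + finrank R (LinearMap.range f) ≤ finrank R M := by
  have : finrank R S ≤ finrank R (LinearMap.ker f) :=
    Cardinal.toNat_le_toNat (Submodule.rank_mono h)
      ((Submodule.rank_le _).trans_lt (rank_lt_aleph0 R M))
  have := finrank_range_add_finrank_ker f
  omega

lemma finrank_weylFil_add_card_le (d : ℕ) :
    finrank R (weylFil R n d) + Fintype.card (Sym (Fin (2 * n)) (d + 1)) ≤
      finrank R (weylFil R n (d + 1)) := by
  set f := (symbol R n (d + 1)).domRestrict (weylFil R n (d + 1))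
  have hle : weylFil R n d ≤ weylFil R n (d + 1) := weylFil_mono (Nat.le_succ d)
  have h1 := finrank_add_finrank_range_le f
    (S := (weylFil R n d).submoduleOf (weylFil R n (d + 1)))
    (fun x hx => symbol_eq_zero_of_mem hx (Nat.lt_succ_self d))
  rw [(Submodule.submoduleOfEquivOfLe hle).finrank_eq] at h1
  refine le_trans (Nat.add_le_add_left ?_ _) h1
  have hmem : ∀ x : Sym (Fin (2 * n)) (d + 1),
      MvPolynomial.monomial (Multiset.toFinsupp (x : Multiset (Fin (2 * n)))) (1 : R) ∈
        LinearMap.range f := by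
    intro x
    have hx : (x : Multiset (Fin (2 * n))).toList.length = d + 1 := by simp
    refine ⟨⟨word R n (x : Multiset (Fin (2 * n))).toList, word_mem_weylFil hx.le⟩, ?_⟩
    have hw := symbol_word (R := R) (x : Multiset (Fin (2 * n))).toList
    rwa [hx, prod_map_X, Multiset.coe_toList] at hw
  refine LinearIndependent.fintype_card_le_finrank (R := R)
    (b := fun x => (⟨_, hmem x⟩ : LinearMap.range f)) ?_
  refine LinearIndependent.of_comp (LinearMap.range f).subtype ?_
  have := (MvPolynomial.basisMonomials (Fin (2 * n)) R).linearIndependent.comp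
    (fun x : Sym (Fin (2 * n)) (d + 1) => Multiset.toFinsupp (x : Multiset (Fin (2 * n))))
    (Multiset.toFinsupp.injective.comp Sym.coe_injective)
  rwa [MvPolynomial.coe_basisMonomials] at this

lemma finrank_map_mkQ_weylFil_le (i : Fin (2 * n)) (d : ℕ) :
    finrank R ((weylFil R n d).map
      (LinearMap.range (LinearMap.mulRight R (weylGen R n i))).mkQ) ≤
        Fintype.card (Sym (Fin (2 * n)) d) := by
  set q := (LinearMap.range (LinearMap.mulRight R (weylGen R n i))).mkQ with hq
  let v : Sym (Fin (2 * n)) d → _ := fun x =>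
    q (word R n ((x : Multiset (Fin (2 * n))).filter (· ≠ i)).toList)
  have hv : Submodule.map q (weylFil R n d) ≤ Submodule.span R (Set.range v) := by
    rw [Submodule.map_le_iff_le_comap]
    suffices ∀ k ≤ d, weylFil R n k ≤ (Submodule.span R (Set.range v)).comap q from this d le_rfl
    intro k
    induction k with
    | zero =>
      intro _
      refine weylFil_le_iff.2 fun l hl => Submodule.subset_span ⟨Sym.replicate d i, ?_⟩
      rw [List.length_eq_zero_iff.1 (Nat.le_zero.1 hl)]
      have : (Multiset.replicate d i).filter (· ≠ i) = 0 :=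
        Multiset.filter_eq_nil.2 fun a ha => by simp [Multiset.eq_of_mem_replicate ha]
      simp only [v, Sym.coe_replicate, this, Multiset.toList_zero]
    | succ k ih =>
      intro hk
      refine weylFil_le_iff.2 fun l hl => ?_
      by_cases hi : i ∈ l
      · have hperm : l.Perm (l.erase i ++ [i]) :=
          (List.perm_cons_erase hi).trans (List.perm_append_singleton i _).symm
        have h1 := ih (by omega) (word_sub_word_mem_of_perm (R := R) hperm k hl)
        have h2 : q (word R n (l.erase i ++ [i])) = 0 := by
          rw [hq, Submodule.mkQ_apply, Submodule.Quotient.mk_eq_zero, word_append]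
          exact ⟨word R n (l.erase i), by simp⟩
        rwa [Submodule.mem_comap, map_sub, h2, sub_zero] at h1
      · have hperm : l.Perm (l : Multiset (Fin (2 * n))).toList := by
          rw [← Multiset.coe_eq_coe, Multiset.coe_toList]
        have h1 := ih (by omega) (word_sub_word_mem_of_perm (R := R) hperm k hl)
        have h2 : q (word R n (l : Multiset (Fin (2 * n))).toList) ∈
            Submodule.span R (Set.range v) := by
          refine Submodule.subset_span ⟨⟨(l : Multiset (Fin (2 * n))) +
            Multiset.replicate (d - l.length) i, by simp; omega⟩, ?_⟩
          have h3 : ((l : Multiset (Fin (2 * n))) +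
              Multiset.replicate (d - l.length) i).filter (· ≠ i) = l := by
            rw [Multiset.filter_add, Multiset.filter_eq_self.2, Multiset.filter_eq_nil.2, add_zero]
            · intro a ha
              simp [Multiset.eq_of_mem_replicate ha]
            · rintro a ha rfl
              exact hi ha
          simp only [v, Sym.coe_mk, h3]
        rw [Submodule.mem_comap, map_sub] at h1
        simpa using add_mem h1 h2
  have : Module.Finite R (Submodule.span R (Set.range v)) :=
    Module.Finite.span_of_finite R (Set.finite_range v)
  exact (Submodule.finrank_mono hv).trans (finrank_range_le_card v)

lemma finrank_weylFil_le (φ : WeylAlgebra R n ≃ₐ[R] WeylAlgebra R n) (i : Fin (2 * n))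
    (hi : weylDeg (φ.symm (weylGen R n i)) ≠ 0) (d : ℕ) :
    finrank R (weylFil R n (d + weylDeg (φ.symm (weylGen R n i)))) ≤ finrank R (weylFil R n d) +
      Fintype.card (Sym (Fin (2 * n))
        (weylDegEquiv φ * (d + weylDeg (φ.symm (weylGen R n i))))) := by
  set G := φ.symm (weylGen R n i) with hG
  set N := d + weylDeg G with hN
  set q := (LinearMap.range (LinearMap.mulRight R (weylGen R n i))).mkQ with hq
  set g := (q.comp φ.toLinearMap).domRestrict (weylFil R n N)
  have hrange : finrank R (LinearMap.range g) ≤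
      Fintype.card (Sym (Fin (2 * n)) (weylDegEquiv φ * N)) := by
    refine (Submodule.finrank_mono ?_).trans (finrank_map_mkQ_weylFil_le i (weylDegEquiv φ * N))
    rintro _ ⟨⟨a, ha⟩, rfl⟩
    exact ⟨φ a, map_mem_weylFil φ ha, rfl⟩
  have hker : finrank R (LinearMap.ker g) ≤ finrank R (weylFil R n d) := by
    rw [← Submodule.finrank_map_subtype_eq]
    refine (Submodule.finrank_mono ?_).trans
      (Submodule.finrank_map_le (LinearMap.mulRight R G) (weylFil R n d))
    rintro _ ⟨⟨a, ha⟩, hag, rfl⟩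
    have hmem : φ a ∈ LinearMap.range (LinearMap.mulRight R (weylGen R n i)) := by
      rw [← Submodule.Quotient.mk_eq_zero]
      exact hag
    obtain ⟨c, hc⟩ := hmem
    have hac : φ.symm c * G = a := by
      rw [hG, ← map_mul]
      exact φ.symm_apply_eq.2 hc
    refine ⟨φ.symm c, ?_, hac⟩
    have := weylDeg_add_le_of_mul_mem hi (Nat.le_add_left _ d) (hac ▸ ha)
    exact weylFil_mono (by omega) (mem_weylFil_weylDeg _)
  have := finrank_range_add_finrank_ker g
  omega

lemma finrank_weylFil_add_mul_card_le (hn : 0 < n) (d e : ℕ) :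
    finrank R (weylFil R n d) + e * Fintype.card (Sym (Fin (2 * n)) d) ≤
      finrank R (weylFil R n (d + e)) := by
  induction e with
  | zero => simp
  | succ e ih =>
    have h1 := finrank_weylFil_add_card_le (R := R) (n := n) (d + e)
    have h2 := card_sym_fin_mono (m := 2 * n) (by omega) (show d ≤ d + e + 1 by omega)
    rw [add_mul, one_mul, ← add_assoc d e 1]
    omega

end Rank

end WeylAlgebra

/-- degree bound theorem for automorphisms of Dirac quantum algebras:
for a commutative domain `R` and an automorphism `φ` of the `n`-th Weyl algebra over
`R`, one has `deg (φ⁻¹) ≤ deg (φ) ^ (2n − 1)`. -/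
theorem weyl_automorphism_inverse_degree_bound
    {R : Type*} [CommRing R] [IsDomain R] {n : ℕ} (hn : 0 < n)
    (φ : WeylAlgebra R n ≃ₐ[R] WeylAlgebra R n) :
    weylDegEquiv φ.symm ≤ weylDegEquiv φ ^ (2 * n - 1) := by
  refine Finset.sup_le fun i _ => ?_
  by_cases hi : weylDeg (φ.symm (weylGen R n i)) = 0
  · simp [hi]
  obtain ⟨k, hk⟩ : ∃ k, 2 * n = k + 1 := ⟨2 * n - 1, by omega⟩
  rw [show 2 * n - 1 = k by omega]
  refine WeylAlgebra.le_pow_of_forall_mul_pow_le fun a =>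
    WeylAlgebra.mul_pow_le_of_mul_card_sym_le ?_
  rw [← hk]
  have h1 := WeylAlgebra.finrank_weylFil_le φ i hi a
  have h2 := WeylAlgebra.finrank_weylFil_add_mul_card_le (R := R) hn a
    (weylDeg (φ.symm (weylGen R n i)))
  omega
end

section
/- Let K be a field and let φ be a K-algebra endomorphism of K[X_1,...,X_m] of degree at most d which is an automorphism. If char(K) = 0 or char(K) > d^{m}, and det(Jφ) ∈ K \ {0}, then deg(φ^{-1}) ≤ d^{m−1} (Gabber's degree bound). -/
open MvPolynomial

/-- The Jacobian matrix of an algebra automorphism of `K[X_1,...,X_m]`. -/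
noncomputable def jacobianMatrixEquiv {K : Type*} [CommRing K] {m : ℕ}
    (φ : MvPolynomial (Fin m) K ≃ₐ[K] MvPolynomial (Fin m) K) :
    Matrix (Fin m) (Fin m) (MvPolynomial (Fin m) K) :=
  fun i j => pderiv j (φ (X i))

namespace MvPolynomial

theorem totalDegree_aeval_le {σ τ R : Type*} [CommSemiring R] {d : ℕ}
    {f : σ → MvPolynomial τ R} (hf : ∀ i, (f i).totalDegree ≤ d) (p : MvPolynomial σ R) :
    (aeval f p).totalDegree ≤ d * p.totalDegree := by
  rw [aeval_def, eval₂_eq]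
  refine totalDegree_finsetSum_le fun s hs => (totalDegree_mul _ _).trans ?_
  rw [algebraMap_eq, totalDegree_C, zero_add]
  calc (∏ i ∈ s.support, f i ^ s i).totalDegree
      ≤ ∑ i ∈ s.support, (f i ^ s i).totalDegree := totalDegree_finsetProd _ _
    _ ≤ ∑ i ∈ s.support, d * s i := Finset.sum_le_sum fun i _ =>
        (totalDegree_pow _ _).trans (by rw [mul_comm]; exact Nat.mul_le_mul_right _ (hf i))
    _ = d * s.sum fun _ e => e := by rw [← Finset.mul_sum, Finsupp.sum]
    _ ≤ d * p.totalDegree := Nat.mul_le_mul_left _ (le_totalDegree hs)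

theorem ncard_setOf_sum_le (σ : Type*) [Fintype σ] (k : ℕ) :
    {s : σ →₀ ℕ | (s.sum fun _ e => e) ≤ k}.ncard
      = (Fintype.card σ + k).choose (Fintype.card σ) := by
  classical
  have hcoe : {s : σ →₀ ℕ | (s.sum fun _ e => e) ≤ k} =
      ((Finset.range (k + 1)).biUnion (Finset.finsuppAntidiag (Finset.univ : Finset σ)) :
        Set (σ →₀ ℕ)) := by
    ext s
    simp [Finsupp.sum_fintype]
  rw [hcoe, Set.ncard_coe_finset, Finset.card_biUnion]
  · simp only [Finset.card_finsuppAntidiag_nat_eq_choose, Finset.card_univ]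
    rw [Nat.choose_symm_add]
    induction k with
    | zero => simp
    | succ k ih =>
      rw [Finset.sum_range_succ, ih (by ext s; simp [Finsupp.sum_fintype]),
        ← add_assoc, Nat.add_sub_cancel, Nat.choose_succ_succ]
  · intro a _ b _ hab
    rw [Function.onFun, Finset.disjoint_left]
    intro s ha hb
    simp only [Finset.mem_finsuppAntidiag] at ha hb
    exact hab (ha.1.symm.trans hb.1)

theorem finrank_restrictTotalDegree (σ K : Type*) [Fintype σ] [Field K] (k : ℕ) :
    Module.finrank K (restrictTotalDegree σ K k)
      = (Fintype.card σ + k).choose (Fintype.card σ) := by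
  rw [← ncard_setOf_sum_le]
  exact Module.finrank_eq_nat_card_basis (basisRestrictSupport K _)

instance finiteDimensional_restrictTotalDegree (σ K : Type*) [Fintype σ] [Field K] (k : ℕ) :
    FiniteDimensional K (restrictTotalDegree σ K k) :=
  have : 0 < Module.finrank K (restrictTotalDegree σ K k) := by
    rw [finrank_restrictTotalDegree]
    exact Nat.choose_pos (Nat.le_add_right _ _)
  .of_finrank_pos this

theorem X_dvd_of_aeval_ne_eq_zero {σ R : Type*} [DecidableEq σ] [CommRing R] (i : σ)
    {p : MvPolynomial σ R}
    (hp : aeval (fun j => if h : j = i then (0 : MvPolynomial {j // j ≠ i} R) else X ⟨j, h⟩) p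
      = 0) : X i ∣ p := by
  rw [← Ideal.mem_span_singleton, ← Ideal.Quotient.eq_zero_iff_mem]
  set I : Ideal (MvPolynomial σ R) := Ideal.span {X i}
  have key : Ideal.Quotient.mkₐ R I = ((Ideal.Quotient.mkₐ R I).comp (rename Subtype.val)).comp
      (aeval (fun j => if h : j = i then (0 : MvPolynomial {j // j ≠ i} R) else X ⟨j, h⟩)) := by
    ext j
    by_cases h : j = i
    · subst h
      have hj : X j ∈ I := Ideal.mem_span_singleton_self _
      simpa [Ideal.Quotient.eq_zero_iff_mem] using hj
    · simp [h]
  have := DFunLike.congr_fun key p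
  rwa [AlgHom.comp_apply, hp, map_zero] at this

end MvPolynomial

theorem Nat.choose_add_mul_choose_le (n k D : ℕ) :
    (n + 1 + k).choose (n + 1) + D * (n + k).choose n ≤ (n + 1 + (k + D)).choose (n + 1) := by
  induction D with
  | zero => simp
  | succ D ih =>
    have h : n + 1 + (k + (D + 1)) = (n + 1 + (k + D)) + 1 := by ring
    have hmono : (n + k).choose n ≤ (n + 1 + (k + D)).choose n := Nat.choose_le_choose n (by omega)
    rw [h, Nat.choose_succ_succ' (n + 1 + (k + D)) n, add_one_mul]
    omega

theorem Nat.le_pow_of_forall_mul_choose_le {n d D : ℕ}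
    (h : ∀ k, D * (n + k).choose n ≤ (n + d * (k + D)).choose n) : D ≤ d ^ n := by
  have hpow (k : ℕ) : D * (k + 1) ^ n ≤ (d * (k + D) + n) ^ n := by
    calc D * (k + 1) ^ n ≤ D * (k + 1).ascFactorial n :=
          Nat.mul_le_mul_left _ (Nat.pow_succ_le_ascFactorial _ _)
      _ = n.factorial * (D * (n + k).choose n) := by
          rw [Nat.ascFactorial_eq_factorial_mul_choose, add_comm k n]; ring
      _ ≤ n.factorial * (n + d * (k + D)).choose n := Nat.mul_le_mul_left _ (h k)
      _ = (d * (k + D) + 1).ascFactorial n := by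
          rw [Nat.ascFactorial_eq_factorial_mul_choose, add_comm n]
      _ ≤ (d * (k + D) + n) ^ n := Nat.ascFactorial_le_pow_add _ _
  have hlim : Filter.Tendsto (fun k : ℕ => ((d : ℝ) + (d * D + n : ℝ) / (k + 1 : ℝ)) ^ n)
      Filter.atTop (nhds ((d : ℝ) ^ n)) := by
    have := (tendsto_one_div_add_atTop_nhds_zero_nat (𝕜 := ℝ)).const_mul (d * D + n : ℝ)
    simpa [div_eq_mul_inv] using (this.const_add (d : ℝ)).pow n
  have hle : (D : ℝ) ≤ (d : ℝ) ^ n := by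
    refine ge_of_tendsto' hlim fun k => ?_
    have hk : (0 : ℝ) < (k : ℝ) + 1 := by positivity
    rw [← mul_le_mul_iff_left₀ (pow_pos hk n), ← mul_pow, add_mul, div_mul_cancel₀ _ hk.ne']
    calc (D : ℝ) * (k + 1) ^ n ≤ (d * (k + D) + n) ^ n := by exact_mod_cast hpow k
      _ ≤ (d * (k + 1) + (d * D + n)) ^ n := by
          refine pow_le_pow_left₀ (by positivity) ?_ n
          have : (0 : ℝ) ≤ d := by positivity
          linarith
  exact_mod_cast hle

/-- A polynomial generating the relations between `n + 1` polynomials of degree at most `d` in `n`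
variables has degree at most `d ^ n`. -/
theorem MvPolynomial.totalDegree_le_pow_of_forall_dvd {σ τ K : Type*} [Fintype σ] [Fintype τ]
    [Field K] {n d : ℕ} (hσ : Fintype.card σ = n + 1) (hτ : Fintype.card τ = n)
    {f : σ → MvPolynomial τ K} (hf : ∀ i, (f i).totalDegree ≤ d) {G : MvPolynomial σ K}
    (hG : ∀ p, aeval f p = 0 → G ∣ p) : G.totalDegree ≤ d ^ n := by
  rcases eq_or_ne G 0 with rfl | hG0
  · simp
  refine Nat.le_pow_of_forall_mul_choose_le fun k => ?_
  set D := G.totalDegree with hD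
  let V := restrictTotalDegree σ K (k + D)
  let θ : V →ₗ[K] MvPolynomial τ K := (aeval f).toLinearMap.domRestrict V
  have hrange : Module.finrank K θ.range ≤ (n + d * (k + D)).choose n := by
    have hle : θ.range ≤ restrictTotalDegree τ K (d * (k + D)) := by
      rintro _ ⟨⟨p, hp⟩, rfl⟩
      rw [mem_restrictTotalDegree] at hp ⊢
      exact (totalDegree_aeval_le hf p).trans (Nat.mul_le_mul_left d hp)
    have := Submodule.finrank_mono hle
    rwa [finrank_restrictTotalDegree, hτ] at this
  have hker : Module.finrank K θ.ker ≤ (n + 1 + k).choose (n + 1) := by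
    have hle : θ.ker.map V.subtype ≤ (restrictTotalDegree σ K k).map (LinearMap.mulLeft K G) := by
      rintro _ ⟨⟨p, hp⟩, hpk, rfl⟩
      obtain ⟨q, rfl⟩ := hG p hpk
      refine ⟨q, ?_, rfl⟩
      rcases eq_or_ne q 0 with rfl | hq
      · exact Submodule.zero_mem _
      rw [mem_restrictTotalDegree, totalDegree_mul_of_isDomain hG0 hq] at hp
      exact (mem_restrictTotalDegree _ _ _).2 (by omega)
    have := (Submodule.finrank_mono hle).trans (Submodule.finrank_map_le _ _)
    rwa [Submodule.finrank_map_subtype_eq, finrank_restrictTotalDegree, hσ] at this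
  have hrank := θ.finrank_range_add_finrank_ker
  rw [finrank_restrictTotalDegree, hσ] at hrank
  have := Nat.choose_add_mul_choose_le n k D
  omega

/-- Gabber's degree bound: let `φ` be an automorphism of
`K[X_1,...,X_m]` of degree at most `d`; if `char K = 0` or `char K > d^m`, and the
Jacobian determinant of `φ` is a nonzero constant, then `deg (φ⁻¹) ≤ d^(m−1)`. -/
theorem gabber_degree_bound
    {K : Type*} [Field K] {m : ℕ} (hm : 1 ≤ m) (d : ℕ)
    (φ : MvPolynomial (Fin m) K ≃ₐ[K] MvPolynomial (Fin m) K)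
    (hdeg : ∀ i : Fin m, (φ (X i)).totalDegree ≤ d)
    (hchar : ringChar K = 0 ∨ ringChar K > d ^ m)
    (hjac : ∃ c : K, c ≠ 0 ∧ (jacobianMatrixEquiv φ).det = C c) :
    ∀ i : Fin m, (φ.symm (X i)).totalDegree ≤ d ^ (m - 1) := by
  intro i
  let ρ : MvPolynomial (Fin m) K →ₐ[K] MvPolynomial {j // j ≠ i} K :=
    aeval fun j => if h : j = i then 0 else X ⟨j, h⟩
  have hρ (p : MvPolynomial (Fin m) K) : (ρ p).totalDegree ≤ p.totalDegree := by
    refine (totalDegree_aeval_le (d := 1) (fun j => ?_) p).trans_eq (one_mul _)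
    split_ifs <;> simp
  have haeval : aeval (fun j => ρ (φ (X j))) = ρ.comp (φ : _ →ₐ[K] _) := by
    ext j
    simp
  refine totalDegree_le_pow_of_forall_dvd (f := fun j => ρ (φ (X j))) (τ := {j // j ≠ i})
    (by simp; omega) (by simp [Fintype.card_subtype_compl]) (fun j => (hρ _).trans (hdeg j))
    fun p hp => ?_
  rw [haeval] at hp
  simpa using map_dvd φ.symm (X_dvd_of_aeval_ne_eq_zero i hp)
end
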